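/- arXiv:2112.03535 — 3 statements merged into one kernel-verified Lean document; each statement's English description precedes it below -/
import Mathlib

section
/- Let Γ = (V,E) be a finite connected simple graph with at least two vertices, and let λ₁ be the second-smallest eigenvalue of its normalized Laplacian L̄. Then λ₁/2 ≤ φ(Γ), where φ(Γ) is the conductance of Γ. -/
open Matrix BigOperators

variable {V : Type*} [Fintype V] [DecidableEq V]

/-- The normalized Laplacian `L̄ = I - D^{-1/2} A D^{-1/2}` of a simple graph. -/
noncomputable def normLap (G : SimpleGraph V) [DecidableRel G.Adj] : Matrix V V ℝ :=
  1 - Matrix.diagonal (fun v => (Real.sqrt (G.degree v))⁻¹) * G.adjMatrix ℝ *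
      Matrix.diagonal (fun v => (Real.sqrt (G.degree v))⁻¹)

/-- The set of edges of `G` with exactly one endpoint in `S`. -/
def edgeBoundary (G : SimpleGraph V) [DecidableRel G.Adj] (S : Finset V) : Finset (Sym2 V) :=
  G.edgeFinset.filter fun e => ∃ a ∈ S, ∃ b ∈ Sᶜ, e = s(a, b)

/-- The volume of a set of vertices: the sum of the degrees of its elements. -/
def vol (G : SimpleGraph V) [DecidableRel G.Adj] (S : Finset V) : ℕ := ∑ x ∈ S, G.degree x

/-- The conductance `φ(Γ)`: the minimum over nonempty proper subsets `S` of
`|∂_E S| / min (vol S) (vol Sᶜ)`. -/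
noncomputable def conductance (G : SimpleGraph V) [DecidableRel G.Adj] : ℝ :=
  sInf {x : ℝ | ∃ S : Finset V, S.Nonempty ∧ S ≠ Finset.univ ∧
    x = (edgeBoundary G S).card / min (vol G S : ℝ) (vol G Sᶜ : ℝ)}

/-- The edge boundary of `S` is counted by the ordered adjacent pairs in `S ×ˢ Sᶜ`. -/
lemma card_edgeBoundary (G : SimpleGraph V) [DecidableRel G.Adj] (S : Finset V) :
    (edgeBoundary G S).card = (G.interedges S Sᶜ).card := by
  symm
  refine Finset.card_bij (fun p _ => s(p.1, p.2)) ?_ ?_ ?_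
  · rintro ⟨a, b⟩ h
    rw [SimpleGraph.mk_mem_interedges_iff] at h
    simp only [edgeBoundary, Finset.mem_filter, SimpleGraph.mem_edgeFinset,
      SimpleGraph.mem_edgeSet]
    exact ⟨h.2.2, a, h.1, b, h.2.1, rfl⟩
  · rintro ⟨a, b⟩ h ⟨c, d⟩ h' heq
    rw [SimpleGraph.mk_mem_interedges_iff, Finset.mem_compl] at h h'
    rcases Sym2.eq_iff.mp heq with ⟨rfl, rfl⟩ | ⟨rfl, rfl⟩
    · rfl
    · exact absurd h.1 h'.2.1
  · intro e he
    simp only [edgeBoundary, Finset.mem_filter, SimpleGraph.mem_edgeFinset] at he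
    obtain ⟨hadj, a, ha, b, hb, rfl⟩ := he
    exact ⟨(a, b), (G.mk_mem_interedges_iff).mpr ⟨ha, hb, hadj⟩, rfl⟩

/-- The Dirichlet energy of a function constant on `S` and on its complement. -/
lemma sum_adj_sq_sub_ite (G : SimpleGraph V) [DecidableRel G.Adj] (S : Finset V) (a b : ℝ) :
    ∑ i, ∑ j, (if G.Adj i j then
      ((if i ∈ S then a else b) - (if j ∈ S then a else b)) ^ 2 else 0) =
      2 * ((a - b) ^ 2 * (edgeBoundary G S).card) := by
  have hcount : ((edgeBoundary G S).card : ℝ) =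
      ∑ i, ∑ j, if i ∈ S ∧ j ∉ S ∧ G.Adj i j then (1 : ℝ) else 0 := by
    rw [card_edgeBoundary, ← Finset.sum_product', Finset.sum_boole]
    congr 2
    ext ⟨i, j⟩
    simp [SimpleGraph.mk_mem_interedges_iff]
  have hcount' : ((edgeBoundary G S).card : ℝ) =
      ∑ i, ∑ j, if j ∈ S ∧ i ∉ S ∧ G.Adj j i then (1 : ℝ) else 0 := by
    rw [hcount, Finset.sum_comm]
  have hsplit : 2 * ((a - b) ^ 2 * ((edgeBoundary G S).card : ℝ)) =
      (a - b) ^ 2 * (edgeBoundary G S).card + (a - b) ^ 2 * (edgeBoundary G S).card := by ring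
  rw [hsplit]
  nth_rewrite 1 [hcount]
  rw [hcount']
  simp only [Finset.mul_sum, ← Finset.sum_add_distrib]
  refine Finset.sum_congr rfl fun i _ => Finset.sum_congr rfl fun j _ => ?_
  by_cases hi : i ∈ S <;> by_cases hj : j ∈ S <;> by_cases hij : G.Adj i j <;>
    simp [hi, hj, hij, G.adj_comm j i]
  ring

/-- The quadratic form of the normalized Laplacian at `D^{1/2} g` is the Dirichlet energy of `g`. -/
lemma dotProduct_normLap_mulVec (G : SimpleGraph V) [DecidableRel G.Adj]
    (hdeg : ∀ v, 0 < G.degree v) (g : V → ℝ) :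
    (fun v => √(G.degree v) * g v) ⬝ᵥ (normLap G *ᵥ fun v => √(G.degree v) * g v) =
      (∑ i, ∑ j, if G.Adj i j then (g i - g j) ^ 2 else 0) / 2 := by
  have hne (v : V) : √(G.degree v : ℝ) ≠ 0 := by
    have := hdeg v
    positivity
  rw [← SimpleGraph.lapMatrix_toLinearMap₂', Matrix.toLinearMap₂'_apply']
  simp only [dotProduct]
  refine Finset.sum_congr rfl fun v _ => ?_
  have hD : (Matrix.diagonal fun v => (√(G.degree v : ℝ))⁻¹) *ᵥ
      (fun v => √(G.degree v) * g v) = g := by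
    ext v
    rw [Matrix.mulVec_diagonal, inv_mul_cancel_left₀ (hne v)]
  rw [normLap, Matrix.sub_mulVec, Matrix.one_mulVec, ← Matrix.mulVec_mulVec, hD,
    ← Matrix.mulVec_mulVec, Pi.sub_apply, Matrix.mulVec_diagonal,
    SimpleGraph.lapMatrix_mulVec_apply, SimpleGraph.adjMatrix_mulVec_apply]
  have hsq : √(G.degree v : ℝ) * √(G.degree v : ℝ) = G.degree v :=
    Real.mul_self_sqrt (Nat.cast_nonneg _)
  have hinv := mul_inv_cancel₀ (hne v)
  linear_combination g v * g v * hsq - (g v * ∑ u ∈ G.neighborFinset v, g u) * hinv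

/-- A vector orthogonal to one eigenvector has Rayleigh quotient at least any lower bound of the
remaining eigenvalues. -/
lemma Matrix.IsHermitian.mul_dotProduct_le_of_orthogonal {A : Matrix V V ℝ} (hA : A.IsHermitian)
    {v₀ : V} {c : ℝ} (hc : ∀ v, v ≠ v₀ → c ≤ hA.eigenvalues v) {f : V → ℝ}
    (hf : hA.eigenvectorBasis v₀ ⬝ᵥ f = 0) :
    c * (f ⬝ᵥ f) ≤ f ⬝ᵥ (A *ᵥ f) := by
  have hparseval (x y : V → ℝ) :
      x ⬝ᵥ y = ∑ i, (hA.eigenvectorBasis i ⬝ᵥ x) * (hA.eigenvectorBasis i ⬝ᵥ y) := by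
    have := hA.eigenvectorBasis.sum_inner_mul_inner (WithLp.toLp 2 x) (WithLp.toLp 2 y)
    simp only [EuclideanSpace.inner_eq_star_dotProduct, star_trivial] at this
    rw [dotProduct_comm, ← this]
    refine Finset.sum_congr rfl fun i _ => ?_
    rw [dotProduct_comm y]
  have heig (i : V) : hA.eigenvectorBasis i ⬝ᵥ (A *ᵥ f) =
      hA.eigenvalues i * (hA.eigenvectorBasis i ⬝ᵥ f) := by
    rw [Matrix.dotProduct_mulVec, ← Matrix.mulVec_transpose,
      ← Matrix.conjTranspose_eq_transpose_of_trivial, hA.eq, hA.mulVec_eigenvectorBasis, smul_dotProduct, smul_eq_mul]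
  rw [hparseval f f, hparseval f (A *ᵥ f), Finset.mul_sum]
  refine Finset.sum_le_sum fun i _ => ?_
  rw [heig]
  by_cases hi : i = v₀
  · subst hi
    simp [hf]
  · nlinarith [mul_le_mul_of_nonneg_right (hc i hi) (mul_self_nonneg (hA.eigenvectorBasis i ⬝ᵥ f))]


/-- **Cheeger inequality, easy direction**: for a finite connected simple graph with at
least two vertices, `λ₁ / 2 ≤ φ(Γ)`, where `λ₁` is the second-smallest eigenvalue of the
normalized Laplacian (eigenvalues listed with multiplicity in nondecreasing order). -/
theorem cheeger_lower (G : SimpleGraph V) [DecidableRel G.Adj]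
    (hconn : G.Connected) (hcard : 2 ≤ Fintype.card V)
    (hL : (normLap G).IsHermitian)
    (ev : Fin (Fintype.card V) → ℝ) (hmono : Monotone ev)
    (σ : V ≃ Fin (Fintype.card V)) (hev : ∀ v, hL.eigenvalues v = ev (σ v)) :
    ev ⟨1, by omega⟩ / 2 ≤ conductance G := by
  have : Nontrivial V := Fintype.one_lt_card_iff_nontrivial.mp hcard
  have hdeg (v : V) : 0 < G.degree v := hconn.preconnected.degree_pos_of_nontrivial v
  have hvol {S : Finset V} (hS : S.Nonempty) : (0 : ℝ) < vol G S :=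
    Nat.cast_pos.mpr (Finset.sum_pos (fun v _ => hdeg v) hS)
  refine le_csInf ?_ ?_
  · obtain ⟨v⟩ := hconn.nonempty
    exact ⟨_, {v}, Finset.singleton_nonempty v, Finset.singleton_ne_univ v, rfl⟩
  rintro x ⟨S, hS, hSu, rfl⟩
  have hSc : Sᶜ.Nonempty := by
    rwa [Finset.nonempty_iff_ne_empty, Ne, Finset.compl_eq_empty_iff]
  set v₀ := σ.symm ⟨0, by omega⟩ with hv₀
  have hc (v : V) (hv : v ≠ v₀) : ev ⟨1, by omega⟩ ≤ hL.eigenvalues v := by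
    rw [hev]
    refine hmono (Fin.mk_le_of_le_val (Nat.one_le_iff_ne_zero.mpr fun h => hv ?_))
    rw [hv₀, Equiv.eq_symm_apply]
    exact Fin.ext h
  obtain ⟨a, b, hab, horth⟩ : ∃ a b : ℝ, 0 < a ^ 2 + b ^ 2 ∧ hL.eigenvectorBasis v₀ ⬝ᵥ
      (fun v => √(G.degree v) * if v ∈ S then a else b) = 0 := by
    set p := ∑ v, hL.eigenvectorBasis v₀ v * (√(G.degree v) * if v ∈ S then 1 else 0) with hp
    set q := ∑ v, hL.eigenvectorBasis v₀ v * (√(G.degree v) * if v ∈ S then 0 else 1) with hq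
    have hlin (a b : ℝ) : hL.eigenvectorBasis v₀ ⬝ᵥ
        (fun v => √(G.degree v) * if v ∈ S then a else b) = a * p + b * q := by
      rw [hp, hq, Finset.mul_sum, Finset.mul_sum, ← Finset.sum_add_distrib]
      refine Finset.sum_congr rfl fun v _ => ?_
      beta_reduce
      split_ifs <;> ring
    by_cases h : p = 0
    · exact ⟨1, 0, by norm_num, by rw [hlin, h]; ring⟩
    · have := sq_pos_of_ne_zero h
      exact ⟨q, -p, by nlinarith [sq_nonneg q], by rw [hlin]; ring⟩
  have hray := hL.mul_dotProduct_le_of_orthogonal hc horth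
  rw [dotProduct_normLap_mulVec G hdeg, sum_adj_sq_sub_ite,
    mul_div_cancel_left₀ _ (two_ne_zero' ℝ)] at hray
  have hnorm : (fun v => √(G.degree v) * if v ∈ S then a else b) ⬝ᵥ
      (fun v => √(G.degree v) * if v ∈ S then a else b) =
      a ^ 2 * vol G S + b ^ 2 * vol G Sᶜ := by
    simp only [dotProduct, vol, Nat.cast_sum, Finset.mul_sum]
    rw [← Finset.sum_add_sum_compl S]
    congr 1 <;> refine Finset.sum_congr rfl fun v hv => ?_
    · rw [if_pos hv, mul_mul_mul_comm, Real.mul_self_sqrt (Nat.cast_nonneg _)]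
      ring
    · rw [if_neg (Finset.mem_compl.mp hv), mul_mul_mul_comm,
        Real.mul_self_sqrt (Nat.cast_nonneg _)]
      ring
  rw [hnorm] at hray
  set l := ev ⟨1, by omega⟩
  set m := min (vol G S : ℝ) (vol G Sᶜ) with hm
  have hmpos : 0 < m := lt_min (hvol hS) (hvol hSc)
  rw [le_div_iff₀ hmpos]
  have hE : (0 : ℝ) ≤ (edgeBoundary G S).card := Nat.cast_nonneg _
  rcases le_or_gt l 0 with hl | hl
  · nlinarith
  have hlow : m * (a ^ 2 + b ^ 2) ≤ a ^ 2 * vol G S + b ^ 2 * vol G Sᶜ := by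
    nlinarith [mul_le_mul_of_nonneg_left (min_le_left (vol G S : ℝ) (vol G Sᶜ)) (sq_nonneg a),
      mul_le_mul_of_nonneg_left (min_le_right (vol G S : ℝ) (vol G Sᶜ)) (sq_nonneg b)]
  have hup : (a - b) ^ 2 * (edgeBoundary G S).card ≤
      2 * (a ^ 2 + b ^ 2) * (edgeBoundary G S).card :=
    mul_le_mul_of_nonneg_right (by nlinarith [sq_nonneg (a + b)]) hE
  have := mul_le_mul_of_nonneg_left hlow hl.le
  refine le_of_mul_le_mul_right ?_ hab
  linarith
end

section
/- Let Γ = (V,E) be a finite connected simple graph with at least two vertices, and let λ₁ be the second-smallest eigenvalue of its normalized Laplacian L̄. Then φ(Γ) ≤ √(2·λ₁), where φ(Γ) is the conductance of Γ. -/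
open Matrix BigOperators

variable {V : Type*} [Fintype V] [DecidableEq V]

/-- The co-area argument: an edge-expansion bound for indicator functions of subsets of the support
of `p ≥ 0` passes to `p` itself. -/
lemma mul_sum_le_sum_abs_sub (w : V → V → ℝ) (c : V → ℝ) (h : ℝ) (S : Finset V)
    (hS : ∀ T ⊆ S, T.Nonempty → h * ∑ v ∈ T, c v ≤
      ∑ u, ∑ v, w u v * |(if u ∈ T then (1 : ℝ) else 0) - if v ∈ T then 1 else 0|)
    (p : V → ℝ) (hpos : ∀ v ∈ S, 0 < p v) (hzero : ∀ v ∉ S, p v = 0) :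
    h * ∑ v, c v * p v ≤ ∑ u, ∑ v, w u v * |p u - p v| := by
  induction S using Finset.strongInduction generalizing p with
  | H S ih =>
    rcases S.eq_empty_or_nonempty with rfl | hne
    · simp [hzero]
    obtain ⟨a, ha, hmin⟩ := S.exists_min_image p hne
    set q : V → ℝ := fun v => p v - p a * if v ∈ S then 1 else 0 with hq
    have key := ih (S.filter fun v => p a < p v)
      (Finset.filter_ssubset.2 ⟨a, ha, lt_irrefl _⟩)
      (fun T hT => hS T (hT.trans (Finset.filter_subset _ _))) q
      (fun v hv => by
        obtain ⟨h1, h2⟩ := Finset.mem_filter.1 hv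
        simp [hq, h1, h2])
      (fun v hv => by
        by_cases hvS : v ∈ S
        · have h1 : ¬ p a < p v := fun h2 => hv (Finset.mem_filter.2 ⟨hvS, h2⟩)
          have h2 := hmin v hvS
          simp only [hq, hvS, if_true]
          linarith
        · simp [hq, hvS, hzero v hvS])
    have hc : ∑ v, c v * p v = ∑ v, c v * q v + p a * ∑ v ∈ S, c v := by
      rw [← Finset.univ_inter S, ← Finset.sum_ite_mem, Finset.mul_sum, ← Finset.sum_add_distrib]
      refine Finset.sum_congr rfl fun v _ => ?_
      simp only [hq]
      split_ifs <;> ring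
    have habs : ∀ u v, |p u - p v| = |q u - q v| +
        p a * |(if u ∈ S then (1 : ℝ) else 0) - if v ∈ S then 1 else 0| := by
      intro u v
      have hpa := hpos a ha
      by_cases hu : u ∈ S <;> by_cases hv : v ∈ S <;> simp only [hq, hu, hv, if_true, if_false]
      · simp
      · have := hmin u hu
        rw [hzero v hv, abs_of_nonneg (by linarith), abs_of_nonneg (by linarith)]
        simp
      · have := hmin v hv
        rw [hzero u hu, abs_of_nonpos (by linarith), abs_of_nonpos (by linarith)]
        simp
      · simp
    have hw : ∑ u, ∑ v, w u v * |p u - p v| = ∑ u, ∑ v, w u v * |q u - q v| +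
        p a * ∑ u, ∑ v, w u v * |(if u ∈ S then (1 : ℝ) else 0) - if v ∈ S then 1 else 0| := by
      simp only [habs, mul_add, Finset.sum_add_distrib, Finset.mul_sum]
      congr 1
      exact Finset.sum_congr rfl fun u _ => Finset.sum_congr rfl fun v _ => by ring
    have := mul_le_mul_of_nonneg_left (hS S subset_rfl hne) (hpos a ha).le
    rw [hc, hw]
    linarith

/-- Cauchy-Schwarz for the differences of squares over a nonnegative weight. -/
lemma sq_sum_abs_sq_sub_sq_le (A : Matrix V V ℝ) (hnn : ∀ u v, 0 ≤ A u v) (g : V → ℝ) :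
    (∑ u, ∑ v, A u v * |g u ^ 2 - g v ^ 2|) ^ 2 ≤
      (∑ u, ∑ v, A u v * (g u - g v) ^ 2) * (∑ u, ∑ v, A u v * (g u + g v) ^ 2) := by
  simp only [← Fintype.sum_prod_type']
  refine Finset.sum_sq_le_sum_mul_sum_of_sq_le_mul _ (fun x _ => ?_) (fun x _ => ?_)
    (fun x _ => ?_)
  · exact mul_nonneg (hnn _ _) (sq_nonneg _)
  · exact mul_nonneg (hnn _ _) (sq_nonneg _)
  · rw [mul_pow, sq_abs]
    exact le_of_eq (by ring)

lemma sum_mul_add_mul_sq (A : Matrix V V ℝ) (hA : A.IsSymm)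
    (d : V → ℝ) (hd : ∀ v, ∑ w, A v w = d v) (g : V → ℝ) (ε : ℝ) (hε : ε ^ 2 = 1) :
    ∑ u, ∑ v, A u v * (g u + ε * g v) ^ 2 =
      2 * ∑ v, d v * g v ^ 2 + 2 * ε * ∑ u, g u * ∑ v, A u v * g v := by
  have h1 : ∑ u, ∑ v, A u v * g u ^ 2 = ∑ v, d v * g v ^ 2 := by
    simp only [← Finset.sum_mul, hd]
  have h2 : ∑ u, ∑ v, A u v * g v ^ 2 = ∑ v, d v * g v ^ 2 := by
    rw [Finset.sum_comm, ← h1]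
    exact Finset.sum_congr rfl fun u _ => Finset.sum_congr rfl fun v _ => by rw [hA.apply]
  calc
    _ = ∑ u, ∑ v, (A u v * g u ^ 2 + A u v * g v ^ 2 + 2 * ε * (g u * (A u v * g v))) :=
      Finset.sum_congr rfl fun u _ => Finset.sum_congr rfl fun v _ => by
        linear_combination A u v * g v ^ 2 * hε
    _ = _ := by
      simp only [Finset.sum_add_distrib, h1, h2, ← Finset.mul_sum]
      ring

lemma sum_mul_sub_sq (A : Matrix V V ℝ) (hA : A.IsSymm)
    (d : V → ℝ) (hd : ∀ v, ∑ w, A v w = d v) (g : V → ℝ) :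
    ∑ u, ∑ v, A u v * (g u - g v) ^ 2 =
      2 * ∑ v, d v * g v ^ 2 - 2 * ∑ u, g u * ∑ v, A u v * g v := by
  simpa [← sub_eq_add_neg] using sum_mul_add_mul_sq A hA d hd g (-1) (by norm_num)

/-- If the positive part of `f` is nonzero, `f` is a generalized eigenvector, and the sets where `f`
is positive expand by a factor of `h`, then `h ≤ √(2 μ)`. -/
lemma le_sqrt_of_expansion (A : Matrix V V ℝ) (hA : A.IsSymm) (hnn : ∀ u v, 0 ≤ A u v)
    (d : V → ℝ) (hd : ∀ v, ∑ w, A v w = d v) (hdpos : ∀ v, 0 < d v) (f : V → ℝ) (μ h : ℝ)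
    (hf : ∀ v, ∑ w, A v w * f w = (1 - μ) * (d v * f v)) (hfpos : ∃ v, 0 < f v) (hh : 0 ≤ h)
    (hS : ∀ T ⊆ Finset.univ.filter (fun v => 0 < f v), T.Nonempty → 2 * h * ∑ v ∈ T, d v ≤
      ∑ u, ∑ v, A u v * |(if u ∈ T then (1 : ℝ) else 0) - if v ∈ T then 1 else 0|) :
    h ≤ √(2 * μ) := by
  set g : V → ℝ := fun v => max (f v) 0 with hg
  have hg0 : ∀ v, 0 ≤ g v := fun v => le_max_right _ _
  have hfg : ∀ v, f v ≤ g v := fun v => le_max_left _ _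
  have hgg : ∀ v, g v * f v = g v ^ 2 := by
    intro v
    rcases le_total (f v) 0 with h1 | h1 <;> simp [hg, h1, sq]
  have hco := mul_sum_le_sum_abs_sub A d (2 * h) _ hS (fun v => g v ^ 2)
    (fun v hv => by
      have : 0 < f v := (Finset.mem_filter.1 hv).2
      have := this.trans_le (hfg v)
      positivity)
    (fun v hv => by
      have : f v ≤ 0 := by simpa using hv
      simp [hg, this])
  have hcs := sq_sum_abs_sq_sub_sq_le A hnn g
  have hminus := sum_mul_sub_sq A hA d hd g
  have hplus := sum_mul_add_mul_sq A hA d hd g 1 (by norm_num)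
  simp only [one_mul, mul_one] at hplus
  have hminus0 : 0 ≤ ∑ u, ∑ v, A u v * (g u - g v) ^ 2 :=
    Finset.sum_nonneg fun u _ => Finset.sum_nonneg fun v _ => mul_nonneg (hnn _ _) (sq_nonneg _)
  have hN : 0 < ∑ v, d v * g v ^ 2 := by
    obtain ⟨v, hv⟩ := hfpos
    refine Finset.sum_pos' (fun v _ => mul_nonneg (hdpos v).le (sq_nonneg _))
      ⟨v, Finset.mem_univ _, ?_⟩
    have := hv.trans_le (hfg v)
    have := hdpos v
    positivity
  have hQ : (1 - μ) * ∑ v, d v * g v ^ 2 ≤ ∑ u, g u * ∑ v, A u v * g v := by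
    rw [Finset.mul_sum]
    refine Finset.sum_le_sum fun u _ => ?_
    calc (1 - μ) * (d u * g u ^ 2) = g u * ∑ v, A u v * f v := by
          rw [hf, ← hgg]; ring
      _ ≤ _ := mul_le_mul_of_nonneg_left (Finset.sum_le_sum fun v _ =>
          mul_le_mul_of_nonneg_left (hfg v) (hnn _ _)) (hg0 u)
  rw [hminus, hplus] at hcs
  rw [hminus] at hminus0
  generalize ∑ v, d v * g v ^ 2 = N at *
  generalize ∑ u, g u * ∑ v, A u v * g v = Q at *
  have h1 : (2 * h * N) ^ 2 ≤ (2 * N - 2 * Q) * (2 * N + 2 * Q) :=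
    (pow_le_pow_left₀ (by positivity) hco 2).trans hcs
  have h2 : (2 * N - 2 * Q) * (2 * N + 2 * Q) ≤ (2 * μ * N) * (4 * N) :=
    (mul_le_mul_of_nonneg_left (by linarith) hminus0).trans
      (mul_le_mul_of_nonneg_right (by linarith) (by positivity))
  refine Real.le_sqrt_of_sq_le (le_of_mul_le_mul_right ?_ (show 0 < 4 * N ^ 2 by positivity))
  linarith

/-- Testing the conductance on a set of at most half of the volume. -/
lemma conductance_mul_le (G : SimpleGraph V) [DecidableRel G.Adj] (hdeg : ∀ v, 0 < G.degree v)
    (T : Finset V) (hT : T.Nonempty) (hvol : vol G T ≤ vol G Tᶜ) :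
    2 * conductance G * ∑ v ∈ T, (G.degree v : ℝ) ≤ ∑ u, ∑ v, G.adjMatrix ℝ u v *
      |(if u ∈ T then (1 : ℝ) else 0) - if v ∈ T then 1 else 0| := by
  have hpos : 0 < vol G T := Finset.sum_pos (fun v _ => hdeg v) hT
  have hne : T ≠ Finset.univ := by
    rintro rfl
    rw [Finset.compl_univ] at hvol
    exact hpos.not_ge (by simpa [vol] using hvol)
  have hle : conductance G ≤ (edgeBoundary G T).card / (vol G T : ℝ) := by
    refine csInf_le ⟨0, ?_⟩ ⟨T, hT, hne, ?_⟩
    · rintro x ⟨S, -, -, rfl⟩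
      positivity
    · rw [min_eq_left (by exact_mod_cast hvol)]
  rw [le_div_iff₀ (by exact_mod_cast hpos)] at hle
  have hcard : ((edgeBoundary G T).card : ℝ) ≤
      ∑ u, ∑ v, G.adjMatrix ℝ u v * if u ∈ T ∧ v ∉ T then 1 else 0 := by
    have hsub : edgeBoundary G T ⊆
        ((Finset.univ : Finset (V × V)).filter
          fun x => G.Adj x.1 x.2 ∧ x.1 ∈ T ∧ x.2 ∉ T).image fun x => s(x.1, x.2) := by
      intro e he
      obtain ⟨h1, a, ha, b, hb, rfl⟩ := Finset.mem_filter.1 he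
      refine Finset.mem_image.2 ⟨(a, b), ?_, rfl⟩
      simpa [ha, Finset.mem_compl.1 hb] using h1
    have h1 := (Finset.card_le_card hsub).trans Finset.card_image_le
    calc ((edgeBoundary G T).card : ℝ) ≤ _ := Nat.cast_le.2 h1
      _ = _ := by
        rw [← Fintype.sum_prod_type', Finset.card_filter]
        push_cast
        refine Finset.sum_congr rfl fun x _ => ?_
        simp only [SimpleGraph.adjMatrix_apply]
        split_ifs <;> simp_all
  have hsymm : ∑ u, ∑ v, G.adjMatrix ℝ u v *
      |(if u ∈ T then (1 : ℝ) else 0) - if v ∈ T then 1 else 0| =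
      2 * ∑ u, ∑ v, G.adjMatrix ℝ u v * if u ∈ T ∧ v ∉ T then 1 else 0 := by
    rw [two_mul]
    nth_rewrite 3 [Finset.sum_comm]
    simp only [← Finset.sum_add_distrib]
    refine Finset.sum_congr rfl fun u _ => Finset.sum_congr rfl fun v _ => ?_
    rw [(G.isSymm_adjMatrix (α := ℝ)).apply u v, ← mul_add]
    by_cases hu : u ∈ T <;> by_cases hv : v ∈ T <;> simp [hu, hv]
  rw [hsymm]
  have : (vol G T : ℝ) = ∑ v ∈ T, (G.degree v : ℝ) := by simp [vol]
  rw [this] at hle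
  linarith

/-- Eigenvectors of the normalized Laplacian, rescaled by `D^{-1/2}`. -/
lemma sum_adjMatrix_mul_eq_of_normLap_mulVec (G : SimpleGraph V) [DecidableRel G.Adj]
    (hdeg : ∀ v, 0 < G.degree v) (x : V → ℝ) (μ : ℝ) (hx : normLap G *ᵥ x = μ • x) (v : V) :
    ∑ w, G.adjMatrix ℝ v w * ((√(G.degree w))⁻¹ * x w) =
      (1 - μ) * (G.degree v * ((√(G.degree v))⁻¹ * x v)) := by
  have hs : 0 < √(G.degree v : ℝ) := Real.sqrt_pos.2 (by exact_mod_cast hdeg v)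
  have hsq : √(G.degree v : ℝ) ^ 2 = G.degree v := Real.sq_sqrt (by positivity)
  have h1 := congrFun hx v
  rw [normLap, sub_mulVec, one_mulVec, ← mulVec_mulVec, ← mulVec_mulVec] at h1
  simp only [Pi.sub_apply, Pi.smul_apply, smul_eq_mul, mulVec_diagonal] at h1
  have h2 : (G.adjMatrix ℝ *ᵥ (diagonal (fun v => (√(G.degree v : ℝ))⁻¹) *ᵥ x)) v =
      ∑ w, G.adjMatrix ℝ v w * ((√(G.degree w))⁻¹ * x w) := by
    rw [mulVec, dotProduct]
    simp only [mulVec_diagonal]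
  rw [h2] at h1
  generalize ∑ w, G.adjMatrix ℝ v w * ((√(G.degree w))⁻¹ * x w) = y at h1 ⊢
  rw [← mul_right_inj' (inv_ne_zero hs.ne')]
  have h3 : (√(G.degree v : ℝ))⁻¹ * G.degree v * (√(G.degree v))⁻¹ = 1 := by
    rw [← hsq, Real.sqrt_sq hs.le]
    field_simp
  linear_combination -h1 - (1 - μ) * x v * h3

lemma sum_adjMatrix (G : SimpleGraph V) [DecidableRel G.Adj] (v : V) :
    ∑ w, G.adjMatrix ℝ v w = (G.degree v : ℝ) := by
  simp only [SimpleGraph.adjMatrix_apply, G.degree_eq_sum_if_adj]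

/-- A rescaled eigenvector with nonpositive eigenvalue is constant. -/
lemma eq_of_eigenvalue_nonpos (G : SimpleGraph V) [DecidableRel G.Adj] (hconn : G.Connected)
    (f : V → ℝ) (μ : ℝ) (hμ : μ ≤ 0)
    (hf : ∀ v, ∑ w, G.adjMatrix ℝ v w * f w = (1 - μ) * (G.degree v * f v)) (a b : V) :
    f a = f b := by
  have hle : ∑ u, ∑ v, G.adjMatrix ℝ u v * (f u - f v) ^ 2 ≤ 0 := by
    rw [sum_mul_sub_sq _ G.isSymm_adjMatrix (fun v => (G.degree v : ℝ))
      (sum_adjMatrix G) f]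
    have h1 : ∑ u, f u * ∑ v, G.adjMatrix ℝ u v * f v =
        (1 - μ) * ∑ v, (G.degree v : ℝ) * f v ^ 2 := by
      rw [Finset.mul_sum]
      exact Finset.sum_congr rfl fun u _ => by rw [hf]; ring
    have h2 : 0 ≤ ∑ v, (G.degree v : ℝ) * f v ^ 2 := Finset.sum_nonneg fun v _ => by positivity
    rw [h1]
    nlinarith
  have hnn : ∀ u v, 0 ≤ G.adjMatrix ℝ u v * (f u - f v) ^ 2 := fun u v => by
    rw [SimpleGraph.adjMatrix_apply]
    split_ifs <;> positivity
  have hadj : ∀ u v, G.Adj u v → f u = f v := by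
    intro u v huv
    have h1 := (Finset.sum_eq_zero_iff_of_nonneg fun u _ => Finset.sum_nonneg fun v _ => hnn u v).1
      (hle.antisymm (Finset.sum_nonneg fun u _ => Finset.sum_nonneg fun v _ => hnn u v))
      u (Finset.mem_univ u)
    have h2 := (Finset.sum_eq_zero_iff_of_nonneg fun v _ => hnn u v).1 h1 v (Finset.mem_univ v)
    simpa [SimpleGraph.adjMatrix_apply, huv, sub_eq_zero] using h2
  obtain ⟨p⟩ := hconn.preconnected a b
  induction p with
  | nil => rfl
  | cons h _ ih => exact (hadj _ _ h).trans ih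

/-- A nonzero rescaled eigenvector with nonzero eigenvalue bounds the conductance. -/
lemma conductance_le_sqrt (G : SimpleGraph V) [DecidableRel G.Adj] (hdeg : ∀ v, 0 < G.degree v)
    (f : V → ℝ) (hf0 : f ≠ 0) (μ : ℝ) (hμ : μ ≠ 0)
    (hf : ∀ v, ∑ w, G.adjMatrix ℝ v w * f w = (1 - μ) * (G.degree v * f v)) :
    conductance G ≤ √(2 * μ) := by
  have hmean : ∑ v, (G.degree v : ℝ) * f v = 0 := by
    have h1 : ∑ v, ∑ w, G.adjMatrix ℝ v w * f w = ∑ v, (G.degree v : ℝ) * f v := by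
      rw [Finset.sum_comm]
      refine Finset.sum_congr rfl fun w _ => ?_
      rw [← Finset.sum_mul, ← sum_adjMatrix G]
      congr 1
      exact Finset.sum_congr rfl fun v _ => G.isSymm_adjMatrix.apply _ _
    simp only [hf, ← Finset.mul_sum] at h1
    have : μ * ∑ v, (G.degree v : ℝ) * f v = 0 := by linarith
    exact (mul_eq_zero.1 this).resolve_left hμ
  wlog hvol : vol G (Finset.univ.filter fun v => 0 < f v) ≤
      vol G (Finset.univ.filter fun v => f v < 0) generalizing f
  · refine this (-f) (neg_ne_zero.2 hf0) (fun v => ?_) (by simpa using hmean) ?_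
    · simpa using hf v
    · simpa using (not_le.1 hvol).le
  have hpos : ∃ v, 0 < f v := by
    by_contra! hcon
    refine hf0 (funext fun v => ?_)
    have h1 := (Finset.sum_eq_zero_iff_of_nonpos fun v _ =>
      mul_nonpos_of_nonneg_of_nonpos (Nat.cast_nonneg (G.degree v)) (hcon v)).1 hmean v
      (Finset.mem_univ v)
    simpa [(hdeg v).ne'] using h1
  refine le_sqrt_of_expansion (G.adjMatrix ℝ) G.isSymm_adjMatrix
    (fun u v => by rw [SimpleGraph.adjMatrix_apply]; split_ifs <;> simp)
    (fun v => (G.degree v : ℝ)) (sum_adjMatrix G) (fun v => by exact_mod_cast hdeg v) f μ _ hf hpos ?_ ?_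
  · refine Real.sInf_nonneg ?_
    rintro x ⟨S, -, -, rfl⟩
    positivity
  · intro T hT hne
    refine conductance_mul_le G hdeg T hne ?_
    refine (Finset.sum_le_sum_of_subset hT).trans (hvol.trans (Finset.sum_le_sum_of_subset ?_))
    intro v hv
    refine Finset.mem_compl.2 fun hvT => ?_
    exact lt_asymm (Finset.mem_filter.1 hv).2 (Finset.mem_filter.1 (hT hvT)).2

/-- **Cheeger inequality, hard direction**: for a finite connected simple graph with at
least two vertices, `φ(Γ) ≤ √(2 λ₁)`, where `λ₁` is the second-smallest eigenvalue of the
normalized Laplacian (eigenvalues listed with multiplicity in nondecreasing order). -/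
theorem cheeger_upper (G : SimpleGraph V) [DecidableRel G.Adj]
    (hconn : G.Connected) (hcard : 2 ≤ Fintype.card V)
    (hL : (normLap G).IsHermitian)
    (ev : Fin (Fintype.card V) → ℝ) (hmono : Monotone ev)
    (σ : V ≃ Fin (Fintype.card V)) (hev : ∀ v, hL.eigenvalues v = ev (σ v)) :
    conductance G ≤ Real.sqrt (2 * ev ⟨1, by omega⟩) := by
  have : Nontrivial V := Fintype.one_lt_card_iff_nontrivial.1 hcard
  have hdeg : ∀ v, 0 < G.degree v := fun v => hconn.preconnected.degree_pos_of_nontrivial v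
  have hs : ∀ v, 0 < √(G.degree v : ℝ) := fun v => Real.sqrt_pos.2 (by exact_mod_cast hdeg v)
  set f : V → V → ℝ := fun j v => (√(G.degree v))⁻¹ * hL.eigenvectorBasis j v with hf
  have heig : ∀ j v, ∑ w, G.adjMatrix ℝ v w * f j w =
      (1 - hL.eigenvalues j) * (G.degree v * f j v) := fun j =>
    sum_adjMatrix_mul_eq_of_normLap_mulVec G hdeg _ _ (hL.mulVec_eigenvectorBasis j)
  have hne : ∀ j, f j ≠ 0 := by
    intro j h0
    refine hL.eigenvectorBasis.orthonormal.ne_zero j ?_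
    ext v
    simpa [hf, (hs v).ne'] using congrFun h0 v
  set i₀ := σ.symm ⟨0, by omega⟩ with hi₀
  set i₁ := σ.symm ⟨1, by omega⟩ with hi₁
  have he₁ : hL.eigenvalues i₁ = ev ⟨1, by omega⟩ := by simp [hev, hi₁]
  have he₀ : hL.eigenvalues i₀ ≤ hL.eigenvalues i₁ := by
    simp only [hev, hi₀, hi₁, Equiv.apply_symm_apply]
    exact hmono (by simp)
  rw [← he₁]
  refine conductance_le_sqrt G hdeg (f i₁) (hne i₁) _ (fun hzero => ?_) (heig i₁)
  have hc₀ := eq_of_eigenvalue_nonpos G hconn _ _ (he₀.trans hzero.le) (heig i₀)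
  have hc₁ := eq_of_eigenvalue_nonpos G hconn _ _ hzero.le (heig i₁)
  obtain ⟨a⟩ := hconn.nonempty
  have hval : ∀ j v, hL.eigenvectorBasis j v = √(G.degree v) * f j v := fun j v => by
    rw [hf, mul_inv_cancel_left₀ (hs v).ne']
  have horth : ∑ v, (G.degree v : ℝ) * (f i₀ a * f i₁ a) = 0 := by
    have h1 := hL.eigenvectorBasis.orthonormal.inner_eq_zero (i := i₀) (j := i₁) (by simp [i₀, i₁])
    rw [PiLp.inner_apply] at h1
    rw [← h1]
    refine Finset.sum_congr rfl fun v _ => ?_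
    rw [hval, hval, hc₀ v a, hc₁ v a]
    simp only [RCLike.inner_apply, conj_trivial]
    nth_rewrite 1 [← Real.mul_self_sqrt (Nat.cast_nonneg (G.degree v))]
    ring
  rw [← Finset.sum_mul] at horth
  have hpos : 0 < ∑ v, (G.degree v : ℝ) :=
    Finset.sum_pos (fun v _ => by exact_mod_cast hdeg v) Finset.univ_nonempty
  rcases mul_eq_zero.1 ((mul_eq_zero.1 horth).resolve_left hpos.ne') with h0 | h0
  · exact hne i₀ (funext fun v => (hc₀ v a).trans h0)
  · exact hne i₁ (funext fun v => (hc₁ v a).trans h0)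
end

section
/- Let Γ = (V,E) be a finite connected simple graph with at least two vertices, let P = A D^{−1} be the transition matrix of the simple random walk, and let 0 = λ₀ ≤ λ₁ ≤ … ≤ λ_{N−1} be the eigenvalues of the normalized Laplacian L̄ (N = |V|). Set β = max(|1 − λ₁|, |1 − λ_{N−1}|). Then for every starting vertex x₀, every vertex x, and every n ≥ 0, |Pⁿ(x₀ → x) − deg(x)/vol(Γ)| ≤ √(deg(x)/deg(x₀)) · βⁿ, where Pⁿ(x₀ → x) denotes the (x, x₀) entry of Pⁿ and vol(Γ) = Σ_{z∈V} deg(z). -/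
open Matrix BigOperators

variable {V : Type*} [Fintype V] [DecidableEq V]

/-- The transition matrix `P = A D⁻¹` of the simple random walk. -/
noncomputable def transMatrix (G : SimpleGraph V) [DecidableRel G.Adj] : Matrix V V ℝ :=
  G.adjMatrix ℝ * (Matrix.diagonal fun v => (G.degree v : ℝ))⁻¹

open Unitary in
/-- Entries of powers of `1 - B` in terms of an orthonormal eigenbasis of `B`. -/
theorem Matrix.IsHermitian.one_sub_pow_apply {B : Matrix V V ℝ} (hB : B.IsHermitian) (n : ℕ)
    (x y : V) :
    ((1 - B) ^ n) x y =
      ∑ j, (1 - hB.eigenvalues j) ^ n * (hB.eigenvectorBasis j x * hB.eigenvectorBasis j y) := by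
  have h : (1 - B) ^ n = conjStarAlgAut ℝ _ hB.eigenvectorUnitary
      (diagonal fun j => (1 - hB.eigenvalues j) ^ n) := by
    conv_lhs => rw [hB.spectral_theorem, ← map_one (conjStarAlgAut ℝ _ hB.eigenvectorUnitary),
      ← map_sub, ← map_pow, ← diagonal_one, diagonal_sub, diagonal_pow]
    rfl
  rw [h, conjStarAlgAut_apply, mul_apply]
  refine Finset.sum_congr rfl fun j _ => ?_
  rw [mul_diagonal, star_apply, IsHermitian.eigenvectorUnitary_apply,
    IsHermitian.eigenvectorUnitary_apply, star_trivial]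
  ring

theorem Matrix.IsHermitian.sum_eigenvectorBasis_sq {B : Matrix V V ℝ} (hB : B.IsHermitian)
    (x : V) : ∑ j, hB.eigenvectorBasis j x ^ 2 = 1 := by
  simpa [sq] using (hB.one_sub_pow_apply 0 x x).symm

/-- Removing one term of the spectral expansion of `(1 - B) ^ n` leaves an error governed by the
remaining eigenvalues. -/
theorem Matrix.IsHermitian.abs_one_sub_pow_apply_sub_le {B : Matrix V V ℝ} (hB : B.IsHermitian)
    (i : V) {β : ℝ} (hβ : ∀ j ≠ i, |1 - hB.eigenvalues j| ≤ β) (hβ₀ : 0 ≤ β) (n : ℕ) (x y : V) :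
    |((1 - B) ^ n) x y - (1 - hB.eigenvalues i) ^ n *
      (hB.eigenvectorBasis i x * hB.eigenvectorBasis i y)| ≤ β ^ n := by
  rw [hB.one_sub_pow_apply, ← Finset.sum_erase_eq_sub (Finset.mem_univ i)]
  have hsum : ∑ j, |hB.eigenvectorBasis j x * hB.eigenvectorBasis j y| ≤ 1 := by
    calc ∑ j, |hB.eigenvectorBasis j x * hB.eigenvectorBasis j y|
        ≤ ∑ j, (hB.eigenvectorBasis j x ^ 2 + hB.eigenvectorBasis j y ^ 2) / 2 := by
          refine Finset.sum_le_sum fun j _ => abs_le.2 ⟨?_, ?_⟩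
          · nlinarith [sq_nonneg (hB.eigenvectorBasis j x + hB.eigenvectorBasis j y)]
          · nlinarith [sq_nonneg (hB.eigenvectorBasis j x - hB.eigenvectorBasis j y)]
      _ = 1 := by
          rw [← Finset.sum_div, Finset.sum_add_distrib, hB.sum_eigenvectorBasis_sq,
            hB.sum_eigenvectorBasis_sq]
          norm_num
  calc _ ≤ ∑ j ∈ Finset.univ.erase i, |(1 - hB.eigenvalues j) ^ n *
          (hB.eigenvectorBasis j x * hB.eigenvectorBasis j y)| := Finset.abs_sum_le_sum_abs _ _
    _ ≤ ∑ j ∈ Finset.univ.erase i,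
          β ^ n * |hB.eigenvectorBasis j x * hB.eigenvectorBasis j y| := by
        refine Finset.sum_le_sum fun j hj => ?_
        rw [abs_mul, abs_pow]
        gcongr
        exact hβ j (Finset.ne_of_mem_erase hj)
    _ ≤ ∑ j, β ^ n * |hB.eigenvectorBasis j x * hB.eigenvectorBasis j y| :=
        Finset.sum_le_sum_of_subset_of_nonneg (Finset.subset_univ _) fun _ _ _ => by positivity
    _ ≤ β ^ n := by
        rw [← Finset.mul_sum]
        exact mul_le_of_le_one_right (by positivity) hsum

section

variable (G : SimpleGraph V) [DecidableRel G.Adj]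

theorem normLap_eq_mul_lapMatrix_mul (hdeg : ∀ v, 0 < G.degree v) :
    normLap G = diagonal (fun v => (Real.sqrt (G.degree v))⁻¹) * G.lapMatrix ℝ *
      diagonal (fun v => (Real.sqrt (G.degree v))⁻¹) := by
  rw [normLap, SimpleGraph.lapMatrix, mul_sub, sub_mul, SimpleGraph.degMatrix,
    diagonal_mul_diagonal, diagonal_mul_diagonal, ← diagonal_one]
  congr 2
  ext v
  have h : (0 : ℝ) < G.degree v := by exact_mod_cast hdeg v
  have hs := Real.sqrt_pos.2 h
  field_simp
  exact Real.sq_sqrt h.le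

theorem posSemidef_normLap (hdeg : ∀ v, 0 < G.degree v) : (normLap G).PosSemidef := by
  rw [normLap_eq_mul_lapMatrix_mul G hdeg]
  simpa [diagonal_conjTranspose] using
    (SimpleGraph.posSemidef_lapMatrix ℝ G).conjTranspose_mul_mul_same
      (diagonal fun v => (Real.sqrt (G.degree v))⁻¹)

theorem det_normLap [Nonempty V] (hdeg : ∀ v, 0 < G.degree v) : (normLap G).det = 0 := by
  rw [normLap_eq_mul_lapMatrix_mul G hdeg, det_mul, det_mul, SimpleGraph.det_lapMatrix_eq_zero]
  simp

/-- On a connected graph the kernel of the normalized Laplacian is spanned by `v ↦ √(deg v)`. -/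
theorem exists_eq_mul_sqrt_degree_of_normLap_mulVec_eq_zero (hconn : G.Connected)
    (hdeg : ∀ v, 0 < G.degree v) {f : V → ℝ} (hf : normLap G *ᵥ f = 0) :
    ∃ c, ∀ v, f v = c * Real.sqrt (G.degree v) := by
  have hs : ∀ v, 0 < Real.sqrt (G.degree v) := fun v =>
    Real.sqrt_pos.2 (by exact_mod_cast hdeg v)
  rw [normLap_eq_mul_lapMatrix_mul G hdeg, ← mulVec_mulVec, ← mulVec_mulVec] at hf
  have hker : G.lapMatrix ℝ *ᵥ (diagonal (fun v => (Real.sqrt (G.degree v))⁻¹) *ᵥ f) = 0 := by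
    ext v
    have := congrFun hf v
    rw [mulVec_diagonal] at this
    exact (mul_eq_zero.1 this).resolve_left (inv_pos.2 (hs v)).ne'
  rw [SimpleGraph.lapMatrix_mulVec_eq_zero_iff_forall_reachable] at hker
  obtain ⟨w⟩ := hconn.nonempty
  refine ⟨(Real.sqrt (G.degree w))⁻¹ * f w, fun v => ?_⟩
  have h := hker v w (hconn.preconnected v w)
  rw [mulVec_diagonal, mulVec_diagonal] at h
  rw [← h]
  have := hs v
  field_simp

theorem transMatrix_pow_apply (hdeg : ∀ v, 0 < G.degree v) (n : ℕ) (x y : V) :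
    (transMatrix G ^ n) x y =
      Real.sqrt (G.degree x) * ((1 - normLap G) ^ n) x y * (Real.sqrt (G.degree y))⁻¹ := by
  have hs : ∀ v, 0 < Real.sqrt (G.degree v) := fun v =>
    Real.sqrt_pos.2 (by exact_mod_cast hdeg v)
  set R : Matrix V V ℝ := diagonal fun v => Real.sqrt (G.degree v) with hR
  set S : Matrix V V ℝ := diagonal fun v => (Real.sqrt (G.degree v))⁻¹ with hS
  have hRS : R * S = 1 := by
    rw [hR, hS, diagonal_mul_diagonal, ← diagonal_one]
    congr 1
    ext v
    exact mul_inv_cancel₀ (hs v).ne'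
  have hSS : (diagonal fun v => (G.degree v : ℝ))⁻¹ = S * S := by
    refine inv_eq_right_inv ?_
    rw [hS, diagonal_mul_diagonal, diagonal_mul_diagonal, ← diagonal_one]
    congr 1
    ext v
    rw [← mul_inv, Real.mul_self_sqrt (Nat.cast_nonneg _)]
    exact mul_inv_cancel₀ (by exact_mod_cast (hdeg v).ne')
  have hconj : SemiconjBy R (1 - normLap G) (transMatrix G) := by
    rw [SemiconjBy, transMatrix, normLap, sub_sub_cancel, hSS, ← hS]
    calc R * (S * G.adjMatrix ℝ * S) = (R * S) * G.adjMatrix ℝ * S := by simp only [mul_assoc]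
      _ = G.adjMatrix ℝ * S * (S * R) := by
        rw [mul_eq_one_comm.1 hRS, hRS, one_mul, mul_one]
      _ = G.adjMatrix ℝ * (S * S) * R := by simp only [mul_assoc]
  have h : transMatrix G ^ n = R * (1 - normLap G) ^ n * S := by
    rw [(hconj.pow_right n).eq, mul_assoc, hRS, mul_one]
  rw [h, hS, mul_diagonal, hR, diagonal_mul]

end

/-- **Convergence of the simple random walk to the stationary distribution**: for a finite
connected simple graph, with `β = max (|1 - λ₁|) (|1 - λ_{N-1}|)` built from the
eigenvalues of the normalized Laplacian listed with multiplicity in nondecreasing order,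
`|Pⁿ(x₀ → x) - deg x / vol Γ| ≤ √(deg x / deg x₀) · βⁿ` for all vertices `x₀, x` and all
`n ≥ 0`.  Here `Pⁿ(x₀ → x)` is the `(x, x₀)` entry of `Pⁿ`. -/
theorem random_walk_convergence (G : SimpleGraph V) [DecidableRel G.Adj]
    (hconn : G.Connected) (hcard : 2 ≤ Fintype.card V)
    (hL : (normLap G).IsHermitian)
    (ev : Fin (Fintype.card V) → ℝ) (hmono : Monotone ev)
    (σ : V ≃ Fin (Fintype.card V)) (hev : ∀ v, hL.eigenvalues v = ev (σ v)) :
    ∀ (x₀ x : V) (n : ℕ),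
      |((transMatrix G ^ n) x x₀) - (G.degree x : ℝ) / ∑ z : V, (G.degree z : ℝ)| ≤
        Real.sqrt ((G.degree x : ℝ) / (G.degree x₀ : ℝ)) *
          (max |1 - ev ⟨1, by omega⟩| |1 - ev ⟨Fintype.card V - 1, by omega⟩|) ^ n := by
  intro x₀ x n
  have : Nontrivial V := Fintype.one_lt_card_iff_nontrivial.1 hcard
  have hdeg : ∀ v, 0 < G.degree v := fun v => hconn.preconnected.degree_pos_of_nontrivial v
  have hd : ∀ v, (0 : ℝ) < G.degree v := fun v => by exact_mod_cast hdeg v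
  have hs : ∀ v, 0 < Real.sqrt (G.degree v) := fun v => Real.sqrt_pos.2 (hd v)
  obtain ⟨k, hk⟩ : ∃ k, hL.eigenvalues k = 0 := by
    have h := det_normLap G hdeg
    rw [hL.det_eq_prod_eigenvalues, Finset.prod_eq_zero_iff] at h
    simpa using h
  set i : V := σ.symm ⟨0, by omega⟩ with hi
  have hi₀ : hL.eigenvalues i = 0 := by
    refine le_antisymm ?_ ((posSemidef_normLap G hdeg).eigenvalues_nonneg i)
    rw [← hk, hev, hev, hi, σ.apply_symm_apply]
    exact hmono (Nat.zero_le _)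
  set β := max |1 - ev ⟨1, by omega⟩| |1 - ev ⟨Fintype.card V - 1, by omega⟩|
  have hβ : ∀ j ≠ i, |1 - hL.eigenvalues j| ≤ β := by
    intro j hj
    have hj₀ : (σ j).val ≠ 0 := fun h => hj (by rw [hi, Equiv.eq_symm_apply]; exact Fin.ext h)
    have h₁ : ev ⟨1, by omega⟩ ≤ ev (σ j) := hmono (Nat.one_le_iff_ne_zero.2 hj₀)
    have h₂ : ev (σ j) ≤ ev ⟨Fintype.card V - 1, by omega⟩ := hmono (Nat.le_sub_one_of_lt (σ j).2)
    rw [hev]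
    refine (abs_le_max_abs_abs (sub_le_sub_left h₂ 1) (sub_le_sub_left h₁ 1)).trans_eq
      (max_comm _ _)
  have hβ₀ : 0 ≤ β := le_max_of_le_left (abs_nonneg _)
  obtain ⟨c, hc⟩ := exists_eq_mul_sqrt_degree_of_normLap_mulVec_eq_zero G hconn hdeg
    (f := hL.eigenvectorBasis i) (by rw [hL.mulVec_eigenvectorBasis, hi₀, zero_smul])
  have hvol : c ^ 2 * ∑ z, (G.degree z : ℝ) = 1 := by
    have h := hL.eigenvectorBasis.orthonormal.1 i
    rw [← sq_eq_sq₀ (norm_nonneg _) zero_le_one, EuclideanSpace.real_norm_sq_eq, one_pow] at h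
    rw [← h, Finset.mul_sum]
    exact Finset.sum_congr rfl fun z _ => by rw [hc, mul_pow, Real.sq_sqrt (hd z).le]
  have hmain := hL.abs_one_sub_pow_apply_sub_le i hβ hβ₀ n x x₀
  rw [hi₀, sub_zero, one_pow, one_mul, hc, hc] at hmain
  have hstat : (G.degree x : ℝ) / ∑ z, (G.degree z : ℝ) = Real.sqrt (G.degree x) *
      (c * Real.sqrt (G.degree x) * (c * Real.sqrt (G.degree x₀))) *
        (Real.sqrt (G.degree x₀))⁻¹ := by
    rw [div_eq_iff (right_ne_zero_of_mul_eq_one hvol)]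
    have := hs x₀
    field_simp
    rw [Real.sq_sqrt (hd x).le, mul_assoc, hvol, mul_one]
  rw [transMatrix_pow_apply G hdeg, hstat, ← sub_mul, ← mul_sub, abs_mul, abs_mul,
    abs_of_pos (hs x), abs_of_pos (inv_pos.2 (hs x₀)), Real.sqrt_div (hd x).le, div_eq_mul_inv,
    mul_right_comm]
  have := hs x
  have := hs x₀
  gcongr
end
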